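/- (Supplementary restrictive hierarchical theorem of the paper, with the hypothesis on κ₁ made precise over the convex hull.) In the ABC-Gibbs hyperparameter kernel setting, assume κ₁ := inf over z in the convex hull of s(ℬ) of m(closed ball of centre z and radius ε/4) > 0 and κ₂ := inf over α ∈ 𝒜 and μ ∈ ℬ of (K α)({μ̃ : ‖s(μ̃) − s(μ)‖ ≤ 3ε/2}) > 0. Then for all α, α̃ ∈ 𝒜, dTV(Q α, Q α̃) ≤ 1 − κ₁κ₂; consequently Q admits a unique invariant probability measure on 𝒜 and converges to it geometrically in total variation with per-step contraction factor 1 − κ₁κ₂. -/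

import Mathlib

open MeasureTheory ProbabilityTheory Classical

/-- Total variation distance between two measures:
`dTV μ ν = sup over measurable sets A of |μ(A) − ν(A)|`. -/
noncomputable def dTV {X : Type*} [MeasurableSpace X] (μ ν : Measure X) : ℝ :=
  ⨆ A : {A : Set X // MeasurableSet A}, |(μ A.1).toReal - (ν A.1).toReal|

open Filter Topology

section TotalVariation

variable {X : Type*} [MeasurableSpace X]

lemma dTV_le {μ ν : Measure X} {c : ℝ}
    (h : ∀ E, MeasurableSet E → |μ.real E - ν.real E| ≤ c) : dTV μ ν ≤ c := by
  have : Nonempty {E : Set X // MeasurableSet E} := ⟨⟨∅, MeasurableSet.empty⟩⟩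
  exact ciSup_le fun E => h E.1 E.2

lemma dTV_nonneg (μ ν : Measure X) : 0 ≤ dTV μ ν :=
  Real.iSup_nonneg fun _ => abs_nonneg _

lemma abs_sub_le_one (μ ν : Measure X) [IsProbabilityMeasure μ] [IsProbabilityMeasure ν]
    (E : Set X) : |μ.real E - ν.real E| ≤ 1 := by
  rw [abs_le]
  constructor <;> linarith [measureReal_nonneg (μ := μ) (s := E),
    measureReal_nonneg (μ := ν) (s := E), measureReal_le_one (μ := μ) (s := E),
    measureReal_le_one (μ := ν) (s := E)]

lemma abs_sub_le_dTV (μ ν : Measure X) [IsProbabilityMeasure μ] [IsProbabilityMeasure ν]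
    {E : Set X} (hE : MeasurableSet E) : |μ.real E - ν.real E| ≤ dTV μ ν := by
  refine le_ciSup (f := fun A : {A : Set X // MeasurableSet A} =>
    |(μ A.1).toReal - (ν A.1).toReal|) ⟨1, ?_⟩ ⟨E, hE⟩
  rintro _ ⟨A, rfl⟩
  exact abs_sub_le_one μ ν A.1

lemma dTV_le_one (μ ν : Measure X) [IsProbabilityMeasure μ] [IsProbabilityMeasure ν] :
    dTV μ ν ≤ 1 := dTV_le fun E _ => abs_sub_le_one μ ν E

lemma eq_of_dTV_nonpos {μ ν : Measure X} [IsProbabilityMeasure μ] [IsProbabilityMeasure ν]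
    (h : dTV μ ν ≤ 0) : μ = ν := by
  ext E hE
  have h1 := (abs_sub_le_dTV μ ν hE).trans h
  have h2 : μ.real E = ν.real E := sub_eq_zero.1 (abs_nonpos_iff.1 h1)
  exact (measureReal_eq_measureReal_iff).1 h2

/-- Integrals of a function of oscillation at most `r` differ by at most `r` times the total
variation distance of the measures. -/
lemma integral_sub_le_mul_dTV (μ ν : Measure X) [IsProbabilityMeasure μ] [IsProbabilityMeasure ν]
    {f : X → ℝ} (hf : Measurable f) (h0 : ∀ x, 0 ≤ f x) (h1 : ∀ x, f x ≤ 1) {r : ℝ} (hr : 0 ≤ r)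
    (hosc : ∀ x y, f x - f y ≤ r) : ∫ x, f x ∂μ - ∫ x, f x ∂ν ≤ r * dTV μ ν := by
  have : Nonempty X := nonempty_of_isProbabilityMeasure μ
  have hbdd : BddBelow (Set.range f) := ⟨0, by rintro _ ⟨x, rfl⟩; exact h0 x⟩
  set a := ⨅ x, f x
  have ha : ∀ x, a ≤ f x := fun x => ciInf_le hbdd x
  have hb : ∀ x, f x ≤ a + r := fun x => by
    have : f x - r ≤ a := le_ciInf fun y => by linarith [hosc x y]
    linarith
  have hint : ∀ (m : Measure X) [IsFiniteMeasure m], Integrable f m := fun m _ =>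
    Integrable.of_bound hf.aestronglyMeasurable 1 (ae_of_all _ fun x => by
      rw [Real.norm_eq_abs, abs_of_nonneg (h0 x)]; exact h1 x)
  obtain ⟨P, hP, hle, hge⟩ := hahn_decomposition μ ν
  have hleP : ν.restrict P ≤ μ.restrict P := Measure.le_iff.2 fun t ht => by
    rw [Measure.restrict_apply ht, Measure.restrict_apply ht]
    exact hle _ (ht.inter hP) Set.inter_subset_right
  have hgeP : μ.restrict Pᶜ ≤ ν.restrict Pᶜ := Measure.le_iff.2 fun t ht => by
    rw [Measure.restrict_apply ht, Measure.restrict_apply ht]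
    exact hge _ (ht.inter hP.compl) Set.inter_subset_right
  have e1 : ∫ x in P, (a + r - f x) ∂ν ≤ ∫ x in P, (a + r - f x) ∂μ :=
    integral_mono_measure hleP (ae_of_all _ fun x => sub_nonneg.2 (hb x))
      ((integrable_const _).sub (hint _))
  have e2 : ∫ x in Pᶜ, (f x - a) ∂μ ≤ ∫ x in Pᶜ, (f x - a) ∂ν :=
    integral_mono_measure hgeP (ae_of_all _ fun x => sub_nonneg.2 (ha x))
      ((hint _).sub (integrable_const _))
  rw [integral_sub (integrable_const _) (hint _), integral_sub (integrable_const _) (hint _),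
    setIntegral_const, setIntegral_const, smul_eq_mul, smul_eq_mul] at e1
  rw [integral_sub (hint _) (integrable_const _), integral_sub (hint _) (integrable_const _),
    setIntegral_const, setIntegral_const, smul_eq_mul, smul_eq_mul,
    probReal_compl_eq_one_sub hP, probReal_compl_eq_one_sub hP] at e2
  have s1 := integral_add_compl hP (hint μ)
  have s2 := integral_add_compl hP (hint ν)
  have hd : r * (μ.real P - ν.real P) ≤ r * dTV μ ν :=
    mul_le_mul_of_nonneg_left ((le_abs_self _).trans (abs_sub_le_dTV μ ν hP)) hr
  linarith

lemma bind_real {Y : Type*} [MeasurableSpace Y] {Q : X → Measure Y} (hQ : Measurable Q)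
    (hQp : ∀ x, IsProbabilityMeasure (Q x)) (μ : Measure X) {E : Set Y} (hE : MeasurableSet E) :
    (μ.bind Q).real E = ∫ x, (Q x).real E ∂μ := by
  rw [measureReal_def, Measure.bind_apply hE hQ.aemeasurable]
  exact (integral_toReal ((Measure.measurable_coe hE).comp hQ).aemeasurable
    (ae_of_all _ fun x => measure_lt_top (Q x) E)).symm

/-- Dobrushin contraction. -/
lemma dTV_bind_le {Y : Type*} [MeasurableSpace Y] {Q : X → Measure Y} (hQ : Measurable Q)
    (hQp : ∀ x, IsProbabilityMeasure (Q x)) {r : ℝ} (hr : 0 ≤ r)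
    (hosc : ∀ x y, dTV (Q x) (Q y) ≤ r)
    (μ ν : Measure X) [IsProbabilityMeasure μ] [IsProbabilityMeasure ν] :
    dTV (μ.bind Q) (ν.bind Q) ≤ r * dTV μ ν := by
  refine dTV_le fun E hE => ?_
  rw [bind_real hQ hQp μ hE, bind_real hQ hQp ν hE]
  have hf : Measurable fun x => (Q x).real E := ((Measure.measurable_coe hE).comp hQ).ennreal_toReal
  have h (m n : Measure X) [IsProbabilityMeasure m] [IsProbabilityMeasure n] :
      ∫ x, (Q x).real E ∂m - ∫ x, (Q x).real E ∂n ≤ r * dTV m n :=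
    integral_sub_le_mul_dTV m n hf (fun x => measureReal_nonneg) (fun x => measureReal_le_one) hr
      fun x y => (le_abs_self _).trans ((abs_sub_le_dTV _ _ hE).trans (hosc x y))
  have hsymm : dTV ν μ = dTV μ ν := by
    simp only [dTV, abs_sub_comm]
  rw [abs_le]
  constructor
  · linarith [h ν μ, hsymm ▸ h ν μ]
  · exact h μ ν

/-- A sequence of probability measures that is geometrically Cauchy in total variation converges
in total variation to a probability measure. -/
lemma exists_limit_of_dTV_le_geometric (u : ℕ → Measure X) (hu : ∀ n, IsProbabilityMeasure (u n))
    {r : ℝ} (hr : r < 1) (h : ∀ n, dTV (u n) (u (n + 1)) ≤ 1 * r ^ n) :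
    ∃ μ : Measure X, IsProbabilityMeasure μ ∧ ∀ n, dTV (u n) μ ≤ 1 * r ^ n / (1 - r) := by
  have hr0 : 0 ≤ r := by simpa using (dTV_nonneg _ _).trans (h 1)
  have hd : ∀ E, MeasurableSet E → ∀ n,
      dist ((u n).real E) ((u (n + 1)).real E) ≤ 1 * r ^ n := fun E hE n =>
    (abs_sub_le_dTV (u n) (u (n + 1)) hE).trans (h n)
  have hlim : ∀ E, ∃ l, MeasurableSet E → Tendsto (fun n => (u n).real E) atTop (𝓝 l) := by
    intro E
    by_cases hE : MeasurableSet E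
    · obtain ⟨l, hl⟩ := cauchySeq_tendsto_of_complete
        (cauchySeq_of_le_geometric r 1 hr (hd E hE))
      exact ⟨l, fun _ => hl⟩
    · exact ⟨0, fun h' => absurd h' hE⟩
  choose L hL using hlim
  have hclose : ∀ E, MeasurableSet E → ∀ n, dist ((u n).real E) (L E) ≤ 1 * r ^ n / (1 - r) :=
    fun E hE n => dist_le_of_le_geometric_of_tendsto r 1 hr (hd E hE) (hL E hE) n
  have hL0 : ∀ E, MeasurableSet E → 0 ≤ L E := fun E hE =>
    ge_of_tendsto' (hL E hE) fun n => measureReal_nonneg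
  have hLempty : L ∅ = 0 := tendsto_nhds_unique (hL ∅ MeasurableSet.empty) (by simp)
  have hLuniv : L Set.univ = 1 := tendsto_nhds_unique (hL _ MeasurableSet.univ) (by simp)
  have hgeo : Tendsto (fun n : ℕ => 1 * r ^ n / (1 - r)) atTop (𝓝 0) := by
    simpa using (tendsto_pow_atTop_nhds_zero_of_lt_one hr0 hr).div_const (1 - r)
  have hsum : ∀ f : ℕ → Set X, (∀ i, MeasurableSet (f i)) → Pairwise (Function.onFun Disjoint f) →
      HasSum (fun i => L (f i)) (L (⋃ i, f i)) := by
    intro f hf hdisj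
    rw [hasSum_iff_tendsto_nat_of_nonneg fun i => hL0 _ (hf i)]
    have hpart : ∀ k n, (u n).real (⋃ i ∈ Finset.range k, f i) =
        ∑ i ∈ Finset.range k, (u n).real (f i) := fun k n =>
      measureReal_biUnion_finset (fun i _ j _ hij => hdisj hij) fun i _ => hf i
    have hmeas : ∀ k, MeasurableSet (⋃ i ∈ Finset.range k, f i) := fun k =>
      Finset.measurableSet_biUnion _ fun i _ => hf i
    have hLpart : ∀ k, L (⋃ i ∈ Finset.range k, f i) = ∑ i ∈ Finset.range k, L (f i) := fun k =>
      tendsto_nhds_unique (hL _ (hmeas k)) (by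
        simp only [hpart]
        exact tendsto_finsetSum _ fun i _ => hL _ (hf i))
    simp only [← hLpart]
    have hunif : TendstoUniformly (fun n k => (u n).real (⋃ i ∈ Finset.range k, f i))
        (fun k => L (⋃ i ∈ Finset.range k, f i)) atTop := by
      rw [Metric.tendstoUniformly_iff]
      intro δ hδ
      filter_upwards [hgeo.eventually_lt_const hδ] with n hn k
      rw [dist_comm]
      exact (hclose _ (hmeas k) n).trans_lt hn
    refine hunif.tendsto_of_eventually_tendsto (Eventually.of_forall fun n => ?_)
      (hL _ (MeasurableSet.iUnion hf))
    simp only [hpart]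
    refine (hasSum_iff_tendsto_nat_of_nonneg (fun i => measureReal_nonneg) _).1 ?_
    have hm := measure_iUnion (μ := u n) hdisj hf
    have := ENNReal.hasSum_toReal (f := fun i => u n (f i)) (by
      rw [← hm]; exact measure_ne_top _ _)
    rwa [← ENNReal.tsum_toReal_eq (fun i => measure_ne_top _ _), ← hm] at this
  let μ : Measure X := Measure.ofMeasurable (fun E _ => ENNReal.ofReal (L E)) (by simp [hLempty])
    (fun f hf hdisj => by
      rw [← (hsum f hf hdisj).tsum_eq, ENNReal.ofReal_tsum_of_nonneg (fun i => hL0 _ (hf i))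
        (hsum f hf hdisj).summable])
  have hμ : ∀ E, MeasurableSet E → μ E = ENNReal.ofReal (L E) := fun E hE =>
    Measure.ofMeasurable_apply E hE
  refine ⟨μ, ⟨by rw [hμ _ MeasurableSet.univ, hLuniv, ENNReal.ofReal_one]⟩, fun n => dTV_le ?_⟩
  intro E hE
  rw [measureReal_def μ, hμ E hE, ENNReal.toReal_ofReal (hL0 E hE)]
  exact hclose E hE n

lemma isProbabilityMeasure_bind_of_forall {Y : Type*} [MeasurableSpace Y] {Q : X → Measure Y}
    (hQ : Measurable Q) (hQp : ∀ x, IsProbabilityMeasure (Q x)) (μ : Measure X)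
    [IsProbabilityMeasure μ] : IsProbabilityMeasure (μ.bind Q) :=
  isProbabilityMeasure_bind hQ.aemeasurable (ae_of_all _ hQp)

/-- Dobrushin's theorem: a Markov kernel contracting total variation is geometrically ergodic. -/
theorem exists_unique_invariant_of_dTV_le [Nonempty X] {Q : X → Measure X} (hQ : Measurable Q)
    (hQp : ∀ x, IsProbabilityMeasure (Q x)) {r : ℝ} (hr : r < 1)
    (hosc : ∀ x y, dTV (Q x) (Q y) ≤ r) :
    ∃ νs : Measure X, IsProbabilityMeasure νs ∧ νs.bind Q = νs ∧
      (∀ ν' : Measure X, IsProbabilityMeasure ν' → ν'.bind Q = ν' → ν' = νs) ∧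
      ∀ ν : Measure X, IsProbabilityMeasure ν → ∀ n : ℕ,
        dTV ((fun m' : Measure X => m'.bind Q)^[n] ν) νs ≤ r ^ n * dTV ν νs := by
  obtain ⟨x₀⟩ := ‹Nonempty X›
  have hr0 : 0 ≤ r := (dTV_nonneg _ _).trans (hosc x₀ x₀)
  have hcontr := fun (μ ν : Measure X) [IsProbabilityMeasure μ] [IsProbabilityMeasure ν] =>
    dTV_bind_le hQ hQp hr0 hosc μ ν
  have hprob : ∀ (ν : Measure X), IsProbabilityMeasure ν → ∀ n,
      IsProbabilityMeasure ((fun m' : Measure X => m'.bind Q)^[n] ν) := by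
    intro ν hν n
    induction n with
    | zero => simpa using hν
    | succ k ih =>
      rw [Function.iterate_succ_apply']
      exact isProbabilityMeasure_bind_of_forall hQ hQp _
  have hiter : ∀ (μ ν : Measure X), IsProbabilityMeasure μ → IsProbabilityMeasure ν → ∀ n,
      dTV ((fun m' : Measure X => m'.bind Q)^[n] μ) ((fun m' : Measure X => m'.bind Q)^[n] ν) ≤
        r ^ n * dTV μ ν := by
    intro μ ν hμ hν n
    induction n with
    | zero => simp
    | succ k ih =>
      rw [Function.iterate_succ_apply', Function.iterate_succ_apply']
      have := hprob μ hμ k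
      have := hprob ν hν k
      calc _ ≤ r * _ := hcontr _ _
        _ ≤ r * (r ^ k * dTV μ ν) := mul_le_mul_of_nonneg_left ih hr0
        _ = _ := by ring
  let ν₀ : Measure X := Measure.dirac x₀
  have hν₁ : IsProbabilityMeasure (ν₀.bind Q) := isProbabilityMeasure_bind_of_forall hQ hQp _
  let u : ℕ → Measure X := fun n => (fun m' : Measure X => m'.bind Q)^[n] ν₀
  have hu : ∀ n, IsProbabilityMeasure (u n) := hprob ν₀ inferInstance
  obtain ⟨νs, hνs, hlim⟩ := exists_limit_of_dTV_le_geometric u hu hr (fun n => by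
    have := hiter ν₀ (ν₀.bind Q) inferInstance hν₁ n
    rw [← Function.iterate_succ_apply (fun m' : Measure X => m'.bind Q)] at this
    rw [one_mul]
    exact this.trans (mul_le_of_le_one_right (pow_nonneg hr0 n) (dTV_le_one _ _)))
  have hνsQ : IsProbabilityMeasure (νs.bind Q) := isProbabilityMeasure_bind_of_forall hQ hQp _
  have hgeo : Tendsto (fun n : ℕ => 1 * r ^ n / (1 - r)) atTop (𝓝 0) := by
    simpa using (tendsto_pow_atTop_nhds_zero_of_lt_one hr0 hr).div_const (1 - r)
  have hinv : νs.bind Q = νs := by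
    refine eq_of_dTV_nonpos (dTV_le fun E hE => ?_)
    have hbound : ∀ n, |(νs.bind Q).real E - νs.real E| ≤
        r * (1 * r ^ n / (1 - r)) + 1 * r ^ (n + 1) / (1 - r) := by
      intro n
      have hstep : u (n + 1) = (u n).bind Q := Function.iterate_succ_apply' _ _ _
      have h1 := (abs_sub_le_dTV (u (n + 1)) νs hE).trans (hlim (n + 1))
      have hpr : IsProbabilityMeasure ((u n).bind Q) := hstep ▸ hu (n + 1)
      have h2 := (abs_sub_le_dTV ((u n).bind Q) (νs.bind Q) hE).trans
        ((hcontr (u n) νs).trans (mul_le_mul_of_nonneg_left (hlim n) hr0))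
      rw [← hstep, abs_sub_comm] at h2
      exact (abs_sub_le _ _ _).trans (add_le_add h2 h1)
    have hzero := (hgeo.const_mul r).add (hgeo.comp (tendsto_add_atTop_nat 1))
    rw [mul_zero, add_zero] at hzero
    exact ge_of_tendsto' hzero hbound
  have hfix : ∀ n, (fun m' : Measure X => m'.bind Q)^[n] νs = νs := fun n =>
    Function.iterate_fixed hinv n
  refine ⟨νs, hνs, hinv, fun ν' hν' h' => eq_of_dTV_nonpos ?_, fun ν hν n => ?_⟩
  · have := hcontr ν' νs
    rw [h', hinv] at this
    nlinarith [dTV_nonneg ν' νs]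
  · simpa only [hfix n] using hiter ν νs hν hνs n

end TotalVariation

/-- The measure of a closed ball of fixed radius is a measurable function of its centre. -/
lemma measurable_measure_closedBall_center {S : Type*} [NormedAddCommGroup S] [NormedSpace ℝ S]
    [MeasurableSpace S] [BorelSpace S] (m : Measure S) [IsFiniteMeasure m] {ε : ℝ} (hε : 0 ≤ ε) :
    Measurable fun x => m (Metric.closedBall x ε) := by
  refine UpperSemicontinuous.measurable fun x y hy => ?_
  have ht := tendsto_measure_cthickening_of_isClosed (μ := m) (s := Metric.closedBall x ε)
    ⟨1, one_pos, measure_ne_top _ _⟩ Metric.isClosed_closedBall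
  obtain ⟨δ, hδ, hδ'⟩ := Metric.eventually_nhds_iff.1 (ht.eventually_lt_const hy)
  filter_upwards [Metric.ball_mem_nhds x (half_pos hδ)] with z hz
  have h1 := hδ' (y := δ / 2) (by rw [Real.dist_0_eq_abs, abs_of_pos (half_pos hδ)]; linarith)
  rw [cthickening_closedBall (half_pos hδ).le hε] at h1
  refine (measure_mono (Metric.closedBall_subset_closedBall' ?_)).trans_lt h1
  linarith [Metric.mem_ball.1 hz]

section ABCGibbs

variable {A B S : Type*} [MeasurableSpace A] [MeasurableSpace B] [MeasurableSpace S]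

/-- The law of the summary statistic of a proposal, restricted to proposals whose
hyperparameter lies in `E`. -/
noncomputable def summaryLaw (ρ : Measure (A × B)) (s : B → S) (E : Set A) : Measure S :=
  (ρ.restrict (Prod.fst ⁻¹' E)).map fun c => s c.2

instance (ρ : Measure (A × B)) [IsFiniteMeasure ρ] (s : B → S) (E : Set A) :
    IsFiniteMeasure (summaryLaw ρ s E) := by
  unfold summaryLaw; infer_instance

lemma summaryLaw_apply (ρ : Measure (A × B)) {s : B → S} (hs : Measurable s) (E : Set A)
    {U : Set S} (hU : MeasurableSet U) :
    summaryLaw ρ s E U = ρ ((fun c => s c.2) ⁻¹' U ∩ Prod.fst ⁻¹' E) := by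
  have hg : Measurable fun c : A × B => s c.2 := hs.comp measurable_snd
  rw [summaryLaw, Measure.map_apply hg hU, Measure.restrict_apply (hg hU)]

variable [NormedAddCommGroup S] [BorelSpace S]

lemma measurable_summaryLaw_closedBall [NormedSpace ℝ S] (ρ : Measure (A × B))
    [IsFiniteMeasure ρ] {s : B → S}
    (hs : Measurable s) (E : Set A) {ε : ℝ} (hε : 0 ≤ ε) :
    Measurable fun μ => summaryLaw ρ s E (Metric.closedBall (s μ) ε) :=
  (measurable_measure_closedBall_center (summaryLaw ρ s E) hε).comp hs

lemma summaryLaw_closedBall_add_compl_ge (ρ : Measure (A × B)) {s : B → S} (hs : Measurable s)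
    {E : Set A} (hE : MeasurableSet E) {ε δ : ℝ} {x y z : S}
    (hx : dist z x + δ ≤ ε) (hy : dist z y + δ ≤ ε) :
    ρ.map (fun c => s c.2) (Metric.closedBall z δ) ≤
      summaryLaw ρ s E (Metric.closedBall x ε) + summaryLaw ρ s Eᶜ (Metric.closedBall y ε) := by
  have hg : Measurable fun c : A × B => s c.2 := hs.comp measurable_snd
  rw [summaryLaw_apply ρ hs E Metric.isClosed_closedBall.measurableSet,
    summaryLaw_apply ρ hs Eᶜ Metric.isClosed_closedBall.measurableSet,
    Measure.map_apply hg Metric.isClosed_closedBall.measurableSet,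
    ← measure_inter_add_sdiff _ (measurable_fst hE)]
  refine add_le_add (measure_mono ?_) (measure_mono ?_)
  · exact Set.inter_subset_inter_left _
      (Set.preimage_mono (Metric.closedBall_subset_closedBall' (by linarith)))
  · exact Set.inter_subset_inter_left _
      (Set.preimage_mono (Metric.closedBall_subset_closedBall' (by linarith)))

lemma measurable_accept_or_stay {s : B → S} (hs : Measurable s) (ε : ℝ) (x : S) (α : A) :
    Measurable fun c : A × B =>
      if ‖s c.2 - x‖ ≤ ε then Measure.dirac c.1 else Measure.dirac α := by
  have hT : MeasurableSet {c : A × B | ‖s c.2 - x‖ ≤ ε} := by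
    have : {c : A × B | ‖s c.2 - x‖ ≤ ε} = (fun c => s c.2) ⁻¹' Metric.closedBall x ε := by
      ext c; simp [dist_eq_norm]
    rw [this]
    exact (hs.comp measurable_snd) Metric.isClosed_closedBall.measurableSet
  exact Measurable.ite hT (Measure.measurable_dirac.comp measurable_fst) measurable_const

lemma bind_accept_or_stay_apply (ρ : Measure (A × B)) [IsProbabilityMeasure ρ] {s : B → S}
    (hs : Measurable s) (ε : ℝ) (x : S) (α : A) {E : Set A} (hE : MeasurableSet E) :
    (ρ.bind (fun c => if ‖s c.2 - x‖ ≤ ε then Measure.dirac c.1 else Measure.dirac α)) E =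
      summaryLaw ρ s E (Metric.closedBall x ε) +
        Measure.dirac α E * (1 - ρ.map (fun c => s c.2) (Metric.closedBall x ε)) := by
  have hg : Measurable fun c : A × B => s c.2 := hs.comp measurable_snd
  have hU : MeasurableSet (Metric.closedBall x ε) := Metric.isClosed_closedBall.measurableSet
  rw [Measure.bind_apply hE (measurable_accept_or_stay hs ε x α).aemeasurable,
    summaryLaw_apply ρ hs E hU, Measure.map_apply hg hU, ← prob_compl_eq_one_sub (hg hU),
    ← lintegral_indicator_one ((hg hU).inter (measurable_fst hE)),
    ← lintegral_indicator_const (hg hU).compl, ← lintegral_add_left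
      (measurable_one.indicator ((hg hU).inter (measurable_fst hE)))]
  refine lintegral_congr fun c => ?_
  by_cases hc : ‖s c.2 - x‖ ≤ ε
  · by_cases hcE : c.1 ∈ E <;>
      simp [hc, hcE, Set.indicator, dist_eq_norm, Measure.dirac_apply' _ hE]
  · simp [hc, Set.indicator, dist_eq_norm]

lemma measurable_bind_accept_or_stay [NormedSpace ℝ S] (ρ : Measure (A × B))
    [IsProbabilityMeasure ρ] {s : B → S} (hs : Measurable s) {ε : ℝ} (hε : 0 ≤ ε) (α : A) :
    Measurable fun μ => ρ.bind
      (fun c => if ‖s c.2 - s μ‖ ≤ ε then Measure.dirac c.1 else Measure.dirac α) := by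
  have hg : Measurable fun c : A × B => s c.2 := hs.comp measurable_snd
  have := Measure.isProbabilityMeasure_map (μ := ρ) hg.aemeasurable
  refine Measure.measurable_of_measurable_coe _ fun E hE => ?_
  simp only [bind_accept_or_stay_apply ρ hs ε _ α hE]
  exact (measurable_summaryLaw_closedBall ρ hs E hε).add
    ((((measurable_measure_closedBall_center (ρ.map fun c => s c.2) hε).comp hs).const_sub
      1).const_mul _)

lemma isProbabilityMeasure_bind_accept_or_stay (ρ : Measure (A × B)) [IsProbabilityMeasure ρ]
    {s : B → S} (hs : Measurable s) (ε : ℝ) (x : S) (α : A) :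
    IsProbabilityMeasure (ρ.bind
      (fun c => if ‖s c.2 - x‖ ≤ ε then Measure.dirac c.1 else Measure.dirac α)) :=
  isProbabilityMeasure_bind_of_forall (measurable_accept_or_stay hs ε x α)
    (fun c => by split_ifs <;> infer_instance) ρ

/-- The hyperparameter update of ABC-Gibbs: from `α`, draw `μ ~ K α` and a proposal from `ρ`, and
accept the proposal when its summary statistic is within `ε` of that of `μ`. -/
noncomputable def abcGibbs (s : B → S) (ε : ℝ) (K : Kernel A B) (ρ : Measure (A × B)) (α : A) :
    Measure A :=
  (K α).bind (fun μ => ρ.bind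
    (fun c => if ‖s c.2 - s μ‖ ≤ ε then Measure.dirac c.1 else Measure.dirac α))

variable {s : B → S} {ε : ℝ} {K : Kernel A B} {ρ : Measure (A × B)}
  [IsProbabilityMeasure ρ] [NormedSpace ℝ S]

lemma abcGibbs_apply (hs : Measurable s) (hε : 0 ≤ ε) (α : A) {E : Set A} (hE : MeasurableSet E) :
    abcGibbs s ε K ρ α E = ∫⁻ μ, summaryLaw ρ s E (Metric.closedBall (s μ) ε) ∂(K α) +
      Measure.dirac α E *
        ∫⁻ μ, (1 - ρ.map (fun c => s c.2) (Metric.closedBall (s μ) ε)) ∂(K α) := by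
  have hg : Measurable fun c : A × B => s c.2 := hs.comp measurable_snd
  have := Measure.isProbabilityMeasure_map (μ := ρ) hg.aemeasurable
  rw [abcGibbs, Measure.bind_apply hE (measurable_bind_accept_or_stay ρ hs hε α).aemeasurable]
  simp only [bind_accept_or_stay_apply ρ hs ε _ α hE]
  rw [lintegral_add_left (measurable_summaryLaw_closedBall ρ hs E hε), lintegral_const_mul]
  exact ((measurable_measure_closedBall_center (ρ.map fun c => s c.2) hε).comp hs).const_sub 1

lemma measurable_abcGibbs (hs : Measurable s) (hε : 0 ≤ ε) : Measurable (abcGibbs s ε K ρ) := by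
  have hg : Measurable fun c : A × B => s c.2 := hs.comp measurable_snd
  have := Measure.isProbabilityMeasure_map (μ := ρ) hg.aemeasurable
  refine Measure.measurable_of_measurable_coe _ fun E hE => ?_
  simp only [abcGibbs_apply hs hε _ hE]
  refine (measurable_summaryLaw_closedBall ρ hs E hε).lintegral_kernel.add
    (((Measure.measurable_coe hE).comp Measure.measurable_dirac).mul
      (Measurable.lintegral_kernel ?_))
  exact ((measurable_measure_closedBall_center (ρ.map fun c => s c.2) hε).comp hs).const_sub 1

variable [IsMarkovKernel K]

lemma isProbabilityMeasure_abcGibbs (hs : Measurable s) (hε : 0 ≤ ε) (α : A) :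
    IsProbabilityMeasure (abcGibbs s ε K ρ α) :=
  isProbabilityMeasure_bind_of_forall (measurable_bind_accept_or_stay ρ hs hε α)
    (fun μ => isProbabilityMeasure_bind_accept_or_stay ρ hs ε (s μ) α) (K α)

lemma le_abcGibbs_add_abcGibbs_compl (hs : Measurable s) (hε : 0 < ε) {κ₁ κ₂ : ENNReal}
    (hκ₁ : ∀ z ∈ convexHull ℝ (Set.range s),
      κ₁ ≤ ρ.map (fun c => s c.2) (Metric.closedBall z (ε / 4)))
    (hκ₂ : ∀ (α : A) (μ : B), κ₂ ≤ K α {μ' | ‖s μ' - s μ‖ ≤ 3 * ε / 2})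
    (α α' : A) {E : Set A} (hE : MeasurableSet E) :
    κ₁ * κ₂ ≤ abcGibbs s ε K ρ α E + abcGibbs s ε K ρ α' Eᶜ := by
  have hpair : ∀ μ μ', ‖s μ' - s μ‖ ≤ 3 * ε / 2 →
      κ₁ ≤ summaryLaw ρ s E (Metric.closedBall (s μ) ε) +
        summaryLaw ρ s Eᶜ (Metric.closedBall (s μ') ε) := by
    intro μ μ' h
    rw [← dist_eq_norm, dist_comm] at h
    refine (hκ₁ (midpoint ℝ (s μ) (s μ')) ?_).trans
      (summaryLaw_closedBall_add_compl_ge ρ hs hE ?_ ?_)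
    · exact (convex_convexHull ℝ _).midpoint_mem (subset_convexHull ℝ _ ⟨μ, rfl⟩)
        (subset_convexHull ℝ _ ⟨μ', rfl⟩)
    · rw [dist_midpoint_left, Real.norm_ofNat]; linarith
    · rw [dist_midpoint_right, Real.norm_ofNat]; linarith
  have hinner : ∀ μ, κ₁ * κ₂ ≤ summaryLaw ρ s E (Metric.closedBall (s μ) ε) +
      ∫⁻ μ', summaryLaw ρ s Eᶜ (Metric.closedBall (s μ') ε) ∂(K α') := by
    intro μ
    have hD : MeasurableSet {μ' | ‖s μ' - s μ‖ ≤ 3 * ε / 2} := by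
      have : {μ' | ‖s μ' - s μ‖ ≤ 3 * ε / 2} = s ⁻¹' Metric.closedBall (s μ) (3 * ε / 2) := by
        ext c; simp [dist_eq_norm]
      rw [this]
      exact hs Metric.isClosed_closedBall.measurableSet
    calc κ₁ * κ₂ ≤ κ₁ * K α' {μ' | ‖s μ' - s μ‖ ≤ 3 * ε / 2} := by gcongr; exact hκ₂ α' μ
      _ = ∫⁻ _ in {μ' | ‖s μ' - s μ‖ ≤ 3 * ε / 2}, κ₁ ∂(K α') := (setLIntegral_const _ _).symm
      _ ≤ ∫⁻ μ' in {μ' | ‖s μ' - s μ‖ ≤ 3 * ε / 2},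
          (summaryLaw ρ s E (Metric.closedBall (s μ) ε) +
            summaryLaw ρ s Eᶜ (Metric.closedBall (s μ') ε)) ∂(K α') :=
        setLIntegral_mono' hD fun μ' h => hpair μ μ' h
      _ ≤ ∫⁻ μ', (summaryLaw ρ s E (Metric.closedBall (s μ) ε) +
            summaryLaw ρ s Eᶜ (Metric.closedBall (s μ') ε)) ∂(K α') := setLIntegral_le_lintegral _ _
      _ = _ := by rw [lintegral_add_left measurable_const, lintegral_const, measure_univ, mul_one]
  rw [abcGibbs_apply hs hε.le α hE, abcGibbs_apply hs hε.le α' hE.compl]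
  calc κ₁ * κ₂ = ∫⁻ _, κ₁ * κ₂ ∂(K α) := by rw [lintegral_const, measure_univ, mul_one]
    _ ≤ ∫⁻ μ, (summaryLaw ρ s E (Metric.closedBall (s μ) ε) +
          ∫⁻ μ', summaryLaw ρ s Eᶜ (Metric.closedBall (s μ') ε) ∂(K α')) ∂(K α) :=
      lintegral_mono hinner
    _ = ∫⁻ μ, summaryLaw ρ s E (Metric.closedBall (s μ) ε) ∂(K α) +
          ∫⁻ μ', summaryLaw ρ s Eᶜ (Metric.closedBall (s μ') ε) ∂(K α') := by
      rw [lintegral_add_right _ measurable_const, lintegral_const, measure_univ, mul_one]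
    _ ≤ _ := add_le_add le_self_add le_self_add

end ABCGibbs

/-- Supplementary restrictive hierarchical theorem of the paper.  In the
ABC-Gibbs hyperparameter kernel setting (from `α` draw `μ ~ K α` and a proposal
`(αᶜ, μᶜ) ~ ρ`, accept `αᶜ` iff `‖s μᶜ − s μ‖ ≤ ε`), if
`κ₁ := inf over z in the convex hull of s(ℬ) of m(closedBall z (ε/4)) > 0` and
`κ₂ := inf over α, μ of (K α){μ̃ : ‖s μ̃ − s μ‖ ≤ 3ε/2} > 0`, then
`dTV (Q α) (Q α̃) ≤ 1 − κ₁κ₂` and the chain has a unique invariant probability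
measure, with geometric convergence at rate `1 − κ₁κ₂`. -/
theorem stmt_9 {A B S : Type*} [MeasurableSpace A] [Nonempty A] [MeasurableSpace B]
    [NormedAddCommGroup S] [NormedSpace ℝ S] [MeasurableSpace S] [BorelSpace S]
    (s : B → S) (hs : Measurable s)
    (ε : ℝ) (hε : 0 < ε)
    (K : Kernel A B) [IsMarkovKernel K]
    (ρ : Measure (A × B)) [IsProbabilityMeasure ρ]
    (Q : A → Measure A)
    (hQ : ∀ α, Q α = (K α).bind (fun μ => ρ.bind
      (fun c => if ‖s c.2 - s μ‖ ≤ ε then Measure.dirac c.1 else Measure.dirac α)))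
    (m : Measure S) (hm : m = ρ.map (fun c => s c.2))
    (κ₁ κ₂ : ℝ) (hκ₁pos : 0 < κ₁) (hκ₂pos : 0 < κ₂)
    (hκ₁ : ∀ z ∈ convexHull ℝ (Set.range s),
      κ₁ ≤ (m (Metric.closedBall z (ε / 4))).toReal)
    (hκ₂ : ∀ (α : A) (μ : B),
      κ₂ ≤ ((K α) {μ' | ‖s μ' - s μ‖ ≤ 3 * ε / 2}).toReal) :
    (∀ α α' : A, dTV (Q α) (Q α') ≤ 1 - κ₁ * κ₂) ∧
    ∃ νs : Measure A, IsProbabilityMeasure νs ∧ νs.bind Q = νs ∧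
      (∀ ν' : Measure A, IsProbabilityMeasure ν' → ν'.bind Q = ν' → ν' = νs) ∧
      ∀ ν : Measure A, IsProbabilityMeasure ν → ∀ n : ℕ,
        dTV ((fun m' : Measure A => m'.bind Q)^[n] ν) νs ≤
          (1 - κ₁ * κ₂) ^ n * dTV ν νs := by
  obtain rfl : Q = abcGibbs s ε K ρ := funext hQ
  have hQm : Measurable (abcGibbs s ε K ρ) := measurable_abcGibbs hs hε.le
  have hQp := isProbabilityMeasure_abcGibbs (K := K) (ρ := ρ) hs hε.le
  subst hm
  have hone_sided : ∀ α α' E, MeasurableSet E →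
      (abcGibbs s ε K ρ α').real E - (abcGibbs s ε K ρ α).real E ≤ 1 - κ₁ * κ₂ := by
    intro α α' E hE
    have h := le_abcGibbs_add_abcGibbs_compl (κ₁ := ENNReal.ofReal κ₁) (κ₂ := ENNReal.ofReal κ₂)
      hs hε (fun z hz => ENNReal.ofReal_le_of_le_toReal (hκ₁ z hz))
      (fun α μ => ENNReal.ofReal_le_of_le_toReal (hκ₂ α μ)) α α' hE
    rw [← ENNReal.ofReal_mul hκ₁pos.le, ENNReal.ofReal_le_iff_le_toReal
      (ENNReal.add_ne_top.2 ⟨measure_ne_top _ _, measure_ne_top _ _⟩),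
      ENNReal.toReal_add (measure_ne_top _ _) (measure_ne_top _ _)] at h
    have hc := probReal_compl_eq_one_sub (μ := abcGibbs s ε K ρ α') hE
    simp only [measureReal_def] at hc ⊢
    linarith
  have hosc : ∀ α α' : A, dTV (abcGibbs s ε K ρ α) (abcGibbs s ε K ρ α') ≤ 1 - κ₁ * κ₂ :=
    fun α α' => dTV_le fun E hE => abs_sub_le_iff.2
      ⟨hone_sided α' α E hE, hone_sided α α' E hE⟩
  exact ⟨hosc, exists_unique_invariant_of_dTV_le hQm hQp
    (sub_lt_self 1 (mul_pos hκ₁pos hκ₂pos)) hosc⟩
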